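/- For every natural number n ≥ 1, the formula α_n = ⋁_{1 ≤ i < j ≤ n+1} ¬¬(¬p_i ∨ p_j) (the disjunction over all pairs 1 ≤ i < j ≤ n+1 of the formulas ¬¬(¬p_i ∨ p_j)) is not derivable in intuitionistic propositional logic: ⊬_i α_n. -/

import Mathlib

/-- The four propositional connectives. -/
inductive Conn : Type
  | conj | disj | impl | nega
deriving DecidableEq

/-- Propositional formulas over countably many letters `p₀, p₁, …`. -/
inductive PropForm : Type
  | var : ℕ → PropForm
  | and : PropForm → PropForm → PropForm
  | or : PropForm → PropForm → PropForm
  | imp : PropForm → PropForm → PropForm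
  | neg : PropForm → PropForm

/-- The set of connectives occurring in a formula. -/
def PropForm.conns : PropForm → Set Conn
  | .var _ => ∅
  | .and a b => insert .conj (a.conns ∪ b.conns)
  | .or a b => insert .disj (a.conns ∪ b.conns)
  | .imp a b => insert .impl (a.conns ∪ b.conns)
  | .neg a => insert .nega a.conns

/-- `φ ∈ 𝔉_F` : the formula `φ` uses only connectives belonging to the fragment `F`. -/
def InFrag (F : Set Conn) (φ : PropForm) : Prop := φ.conns ⊆ F

/-- Derivability `Γ ⊢_F φ` for the fragment `F`: the least relation closed under
membership, monotonicity, cut, and the two directions of the rules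
(R∧), (R∨), (R→), (R¬I), (R¬E) for the connectives in `F`. -/
inductive Deriv (F : Set Conn) : Set PropForm → PropForm → Prop
  | mem {Γ : Set PropForm} {φ : PropForm} : φ ∈ Γ → Deriv F Γ φ
  | mono {Γ : Set PropForm} {φ ψ : PropForm} : Deriv F Γ φ → Deriv F (insert ψ Γ) φ
  | cut {Γ Δ : Set PropForm} {φ ψ : PropForm} :
      Deriv F Γ φ → Deriv F (insert φ Δ) ψ → Deriv F (Γ ∪ Δ) ψ
  | andI {Γ : Set PropForm} {φ ψ : PropForm} :
      Conn.conj ∈ F → Deriv F Γ φ → Deriv F Γ ψ → Deriv F Γ (.and φ ψ)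
  | andE1 {Γ : Set PropForm} {φ ψ : PropForm} :
      Conn.conj ∈ F → Deriv F Γ (.and φ ψ) → Deriv F Γ φ
  | andE2 {Γ : Set PropForm} {φ ψ : PropForm} :
      Conn.conj ∈ F → Deriv F Γ (.and φ ψ) → Deriv F Γ ψ
  | orI {Γ : Set PropForm} {φ ψ χ : PropForm} :
      Conn.disj ∈ F → Deriv F (insert φ Γ) χ → Deriv F (insert ψ Γ) χ →
      Deriv F (insert (.or φ ψ) Γ) χ
  | orE1 {Γ : Set PropForm} {φ ψ χ : PropForm} :
      Conn.disj ∈ F → Deriv F (insert (.or φ ψ) Γ) χ → Deriv F (insert φ Γ) χ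
  | orE2 {Γ : Set PropForm} {φ ψ χ : PropForm} :
      Conn.disj ∈ F → Deriv F (insert (.or φ ψ) Γ) χ → Deriv F (insert ψ Γ) χ
  | impI {Γ : Set PropForm} {φ ψ : PropForm} :
      Conn.impl ∈ F → Deriv F (insert φ Γ) ψ → Deriv F Γ (.imp φ ψ)
  | impE {Γ : Set PropForm} {φ ψ : PropForm} :
      Conn.impl ∈ F → Deriv F Γ (.imp φ ψ) → Deriv F (insert φ Γ) ψ
  | negI {Γ : Set PropForm} {φ ψ : PropForm} :
      Conn.nega ∈ F → Deriv F (insert φ Γ) ψ → Deriv F (insert φ Γ) (.neg ψ) →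
      Deriv F Γ (.neg φ)
  | negE {Γ : Set PropForm} {φ ψ : PropForm} :
      Conn.nega ∈ F → Deriv F Γ φ → Deriv F Γ (.neg φ) → Deriv F Γ ψ

/-- An algebra interpreting the connectives on a carrier `V`. -/
structure Alg (V : Type) where
  and : V → V → V
  or : V → V → V
  imp : V → V → V
  neg : V → V

/-- The homomorphic extension of an assignment `v` of letters. -/
def Alg.eval {V : Type} (A : Alg V) (v : ℕ → V) : PropForm → V
  | .var n => v n
  | .and a b => A.and (A.eval v a) (A.eval v b)
  | .or a b => A.or (A.eval v a) (A.eval v b)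
  | .imp a b => A.imp (A.eval v a) (A.eval v b)
  | .neg a => A.neg (A.eval v a)

/-- Semantic consequence `Γ ⊨_{A,D} φ`. -/
def SemConseq {V : Type} (A : Alg V) (D : Set V) (Γ : Set PropForm) (φ : PropForm) : Prop :=
  ∀ v : ℕ → V, (∀ ψ ∈ Γ, A.eval v ψ ∈ D) → A.eval v φ ∈ D

/-- The fragment `F` has a finite semantics. -/
def HasFiniteSemantics (F : Set Conn) : Prop :=
  ∃ (V : Type) (_ : Fintype V) (A : Alg V) (D : Set V),
    ∀ (Γ : Set PropForm) (φ : PropForm),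
      (∀ ψ ∈ Γ, InFrag F ψ) → InFrag F φ →
      (Deriv F Γ φ ↔ SemConseq A D Γ φ)

/-- `φ ∨̇ ψ = (φ → ψ) → ψ`. -/
def dvee (a b : PropForm) : PropForm := .imp (.imp a b) b

/-- Left-associated iterated `∨̇` of a list of formulas. -/
def bigDvee : List PropForm → PropForm
  | [] => .var 0
  | a :: rest => rest.foldl dvee a

/-- Left-associated iterated `∨` of a list of formulas. -/
def bigOrF : List PropForm → PropForm
  | [] => .var 0
  | a :: rest => rest.foldl PropForm.or a

/-- All pairs `(i, j)` with `1 ≤ i < j ≤ n+1`. -/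
def pairs (n : ℕ) : List (ℕ × ℕ) :=
  (List.range' 2 n).flatMap fun j => (List.range' 1 (j - 1)).map fun i => (i, j)

/-- `α_n = ∨̇_{1 ≤ i < j ≤ n+1} (p_j → p_i)`. -/
def alphaImp (n : ℕ) : PropForm :=
  bigDvee ((pairs n).map fun p => .imp (.var p.2) (.var p.1))

/-- `α_n = ⋁_{1 ≤ i < j ≤ n+1} ¬¬(¬p_i ∨ p_j)`. -/
def alphaOrNeg (n : ℕ) : PropForm :=
  bigOrF ((pairs n).map fun p => .neg (.neg (.or (.neg (.var p.1)) (.var p.2))))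

/-- Two-valued Boolean evaluation. -/
def evalBool (v : ℕ → Bool) : PropForm → Bool
  | .var n => v n
  | .and a b => evalBool v a && evalBool v b
  | .or a b => evalBool v a || evalBool v b
  | .imp a b => !evalBool v a || evalBool v b
  | .neg a => !evalBool v a

/-- Classical (two-valued) consequence `Γ ⊢_c φ`. -/
def ClassConseq (Γ : Set PropForm) (φ : PropForm) : Prop :=
  ∀ v : ℕ → Bool, (∀ ψ ∈ Γ, evalBool v ψ = true) → evalBool v φ = true

/-- The two-element Boolean algebra `𝟐`. -/
def alg2 : Alg Bool where
  and a b := a && b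
  or a b := a || b
  imp a b := !a || b
  neg a := !a

/-- The three-element algebra `𝟑` on the chain `0 < 1/2 < 1` (coded as `0 < 1 < 2` in `Fin 3`),
with meet `min` and meet complement `¬0 = 1`, `¬(1/2) = ¬1 = 0` (its `or`/`imp` are those of the
3-element Heyting chain). -/
def alg3 : Alg (Fin 3) where
  and a b := min a b
  or a b := max a b
  imp a b := if a ≤ b then 2 else b
  neg a := if a = 0 then 2 else 0

/-- The `(n+1)`-element Heyting chain, coded on `Fin (n+1)` (so `k` codes the element `k+1`). -/
def chainAlg (n : ℕ) : Alg (Fin (n + 1)) where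
  and a b := min a b
  or a b := max a b
  imp a b := if a ≤ b then Fin.last n else b
  neg a := if a = 0 then Fin.last n else 0

/-- Kripke forcing over a preorder `W`, where `V w n` says that the letter `n` holds at `w`. -/
def PropForm.Forces {W : Type*} [Preorder W] (V : W → ℕ → Prop) : W → PropForm → Prop
  | w, .var n => V w n
  | w, .and a b => Forces V w a ∧ Forces V w b
  | w, .or a b => Forces V w a ∨ Forces V w b
  | w, .imp a b => ∀ u, w ≤ u → Forces V u a → Forces V u b
  | w, .neg a => ∀ u, w ≤ u → ¬ Forces V u a

/-- Forcing is persistent as soon as it is persistent on letters. -/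
theorem PropForm.Forces.of_le {W : Type*} [Preorder W] {V : W → ℕ → Prop} (hV : Monotone V)
    {φ : PropForm} {w u : W} (h : w ≤ u) (hφ : φ.Forces V w) : φ.Forces V u := by
  induction φ with
  | var n => exact hV h n hφ
  | and a b iha ihb => exact hφ.imp iha ihb
  | or a b iha ihb => exact Or.imp iha ihb hφ
  | imp a b _ _ => exact fun x hx => hφ x (h.trans hx)
  | neg a _ => exact fun x hx => hφ x (h.trans hx)

/-- Kripke soundness of derivability in any fragment. -/
theorem Deriv.forces {F : Set Conn} {Γ : Set PropForm} {φ : PropForm} (d : Deriv F Γ φ)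
    {W : Type*} [Preorder W] {V : W → ℕ → Prop} (hV : Monotone V) (w : W)
    (hΓ : ∀ ψ ∈ Γ, ψ.Forces V w) : φ.Forces V w := by
  induction d generalizing w with
  | mem h => exact hΓ _ h
  | mono _ ih => exact ih w fun ψ hψ => hΓ ψ (.inr hψ)
  | cut _ _ ih₁ ih₂ =>
    exact ih₂ w (Set.forall_mem_insert.2
      ⟨ih₁ w fun ψ hψ => hΓ ψ (.inl hψ), fun ψ hψ => hΓ ψ (.inr hψ)⟩)
  | andI _ _ _ ih₁ ih₂ => exact ⟨ih₁ w hΓ, ih₂ w hΓ⟩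
  | andE1 _ _ ih => exact (ih w hΓ).1
  | andE2 _ _ ih => exact (ih w hΓ).2
  | orI _ _ _ ih₁ ih₂ =>
    obtain ⟨h, hΓ⟩ := Set.forall_mem_insert.1 hΓ
    exact h.elim (fun h => ih₁ w (Set.forall_mem_insert.2 ⟨h, hΓ⟩))
      fun h => ih₂ w (Set.forall_mem_insert.2 ⟨h, hΓ⟩)
  | orE1 _ _ ih =>
    obtain ⟨h, hΓ⟩ := Set.forall_mem_insert.1 hΓ
    exact ih w (Set.forall_mem_insert.2 ⟨.inl h, hΓ⟩)
  | orE2 _ _ ih =>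
    obtain ⟨h, hΓ⟩ := Set.forall_mem_insert.1 hΓ
    exact ih w (Set.forall_mem_insert.2 ⟨.inr h, hΓ⟩)
  | impI _ _ ih =>
    exact fun u hu ha => ih u (Set.forall_mem_insert.2 ⟨ha, fun ψ hψ => (hΓ ψ hψ).of_le hV hu⟩)
  | impE _ _ ih =>
    obtain ⟨h, hΓ⟩ := Set.forall_mem_insert.1 hΓ
    exact ih w hΓ w le_rfl h
  | negI _ _ _ ih₁ ih₂ =>
    intro u hu ha
    have hΔ := Set.forall_mem_insert.2 ⟨ha, fun ψ hψ => (hΓ ψ hψ).of_le hV hu⟩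
    exact ih₂ u hΔ u le_rfl (ih₁ u hΔ)
  | negE _ _ _ ih₁ ih₂ => exact absurd (ih₁ w hΓ) (ih₂ w hΓ w le_rfl)

theorem PropForm.forces_foldl_or {W : Type*} [Preorder W] {V : W → ℕ → Prop} {w : W}
    (l : List PropForm) (a : PropForm) :
    (l.foldl PropForm.or a).Forces V w ↔ ∃ φ ∈ a :: l, φ.Forces V w := by
  induction l generalizing a with
  | nil => simp
  | cons b l ih => simp [ih, Forces, or_assoc]

/-- A world forces a nonempty iterated disjunction iff it forces one of the disjuncts. -/
theorem forces_bigOrF {W : Type*} [Preorder W] {V : W → ℕ → Prop} {w : W}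
    {l : List PropForm} (hl : l ≠ []) :
    (bigOrF l).Forces V w ↔ ∃ φ ∈ l, φ.Forces V w := by
  cases l with
  | nil => exact absurd rfl hl
  | cons a l => exact PropForm.forces_foldl_or l a

theorem lt_of_mem_pairs {n : ℕ} {p : ℕ × ℕ} (hp : p ∈ pairs n) : p.1 < p.2 := by
  simp only [pairs, List.mem_flatMap, List.mem_map, List.mem_range'_1] at hp
  obtain ⟨j, hj, i, hi, rfl⟩ := hp
  dsimp only
  omega

theorem pairs_ne_nil {n : ℕ} (hn : 1 ≤ n) : pairs n ≠ [] := by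
  refine List.ne_nil_of_mem (a := (1, 2)) ?_
  simp only [pairs, List.mem_flatMap, List.mem_map, List.mem_range'_1]
  exact ⟨2, by omega, 1, by omega, rfl⟩

/-- The tree of height two: a root below pairwise incomparable leaves indexed by `α`. -/
inductive Fan (α : Type*)
  | root : Fan α
  | leaf : α → Fan α

instance (α : Type*) : Preorder (Fan α) where
  le a b := a = .root ∨ a = b
  le_refl _ := .inr rfl
  le_trans a b c := by
    rintro (rfl | rfl) h
    · exact .inl rfl
    · exact h

theorem Fan.eq_of_leaf_le {α : Type*} {i : α} {u : Fan α} (h : .leaf i ≤ u) : u = .leaf i :=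
  h.elim (fun h => nomatch h) Eq.symm

/-- for `n ≥ 1`, `α_n = ⋁_{1 ≤ i < j ≤ n+1} ¬¬(¬p_i ∨ p_j)` is not
intuitionistically derivable. -/
theorem alphaOrNeg_not_derivable (n : ℕ) (hn : 1 ≤ n) :
    ¬ Deriv (Set.univ : Set Conn) ∅ (alphaOrNeg n) := by
  intro d
  let V : Fan ℕ → ℕ → Prop := fun w i => w = .leaf i
  have hV : Monotone V := by
    rintro a b (rfl | rfl) i h
    · cases h
    · exact h
  obtain ⟨φ, hφ, hforces⟩ := (forces_bigOrF (by simpa using pairs_ne_nil hn)).1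
    (d.forces hV .root (by simp))
  obtain ⟨⟨i, j⟩, hp, rfl⟩ := List.mem_map.1 hφ
  have hij : i < j := lt_of_mem_pairs hp
  refine hforces (.leaf i) (.inl rfl) fun u hu => ?_
  obtain rfl := Fan.eq_of_leaf_le hu
  rintro (h | h)
  · exact h (.leaf i) le_rfl rfl
  · exact hij.ne (Fan.leaf.inj h)
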